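/- Define S₁ as the set of pairs ( Σ_{x ∈ supp σ} σ(x)·Σ_{k=1}^K φ_k(x)·U_c(v_k, x), Σ_{x ∈ supp σ} σ(x)·Σ_{k=1}^K φ_k(x)·U_p(v_k, x) ), where σ ranges over finitely supported functions from Δ to [0,1] with Σ_{x} σ(x) = 1 and Σ_{x} σ(x)·x = x* (segmentations of the aggregate market), and φ : Δ → ℝ^K ranges over pricing rules with φ_k(x) ≥ 0, Σ_{k=1}^K φ_k(x) = 1 for all x, and φ_k(x) > 0 only if x ∈ X_k^β (optimal pricing rules). Then S₁ = S'. (In particular, it suffices to consider segmentations in which, for each value v_k, at most one segment is priced at v_k.) -/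

import Mathlib

/-- The set of markets: the standard simplex on value indices `1, …, K`. -/
def simplex (K : ℕ) : Set (ℕ → ℝ) :=
  {x | (∀ k ∈ Finset.Icc 1 K, 0 ≤ x k) ∧ ∑ k ∈ Finset.Icc 1 K, x k = 1}

/-- Producer utility `U_p(v_i, x) = v_i · Σ_{k=i}^K x_k`. -/
noncomputable def Up (K : ℕ) (v : ℕ → ℝ) (i : ℕ) (x : ℕ → ℝ) : ℝ :=
  v i * ∑ k ∈ Finset.Icc i K, x k

/-- Consumer utility `U_c(v_i, x) = Σ_{k=i}^K x_k · (v_k − v_i)`. -/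
noncomputable def Uc (K : ℕ) (v : ℕ → ℝ) (i : ℕ) (x : ℕ → ℝ) : ℝ :=
  ∑ k ∈ Finset.Icc i K, x k * (v k - v i)

/-- `X_i^β`: the set of markets for which `v_i` is an optimal price under the
privacy mechanism with parameter `β`. -/
def Xopt (K : ℕ) (v : ℕ → ℝ) (β : ℝ) (i : ℕ) : Set (ℕ → ℝ) :=
  {x | x ∈ simplex K ∧ ∀ j ∈ Finset.Icc 1 K,
    v i * ((1 - β) * ∑ k ∈ Finset.Icc i K, x k + β * ((K : ℝ) + 1 - i) / K) ≥
      v j * ((1 - β) * ∑ k ∈ Finset.Icc j K, x k + β * ((K : ℝ) + 1 - j) / K)}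

/-- The set `S'` of consumer/producer utility pairs achievable by segmentations in
which, for each value `v_k`, at most one segment is priced at `v_k`. -/
def Sprime (K : ℕ) (v : ℕ → ℝ) (β : ℝ) (xstar : ℕ → ℝ) : Set (ℝ × ℝ) :=
  {p | ∃ (γ : ℕ → ℝ) (xs : ℕ → ℕ → ℝ),
    (∀ k ∈ Finset.Icc 1 K, 0 ≤ γ k) ∧
    (∑ k ∈ Finset.Icc 1 K, γ k) = 1 ∧
    (∀ k ∈ Finset.Icc 1 K, xs k ∈ simplex K) ∧
    (∀ k ∈ Finset.Icc 1 K, 0 < γ k → xs k ∈ Xopt K v β k) ∧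
    (∀ j ∈ Finset.Icc 1 K, ∑ k ∈ Finset.Icc 1 K, γ k * xs k j = xstar j) ∧
    p = (∑ k ∈ Finset.Icc 1 K, γ k * Uc K v k (xs k),
         ∑ k ∈ Finset.Icc 1 K, γ k * Up K v k (xs k))}

/-- A finite family of nonnegative weights on markets has a barycenter, and a default point may be
prescribed when the total weight vanishes. -/
theorem exists_barycenter (s : Finset (ℕ → ℝ)) (m : (ℕ → ℝ) → ℝ) (hm : ∀ x ∈ s, 0 ≤ m x)
    (z : ℕ → ℝ) :
    ∃ y : ℕ → ℝ, (∀ j, (∑ x ∈ s, m x) * y j = ∑ x ∈ s, m x * x j) ∧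
      (∑ x ∈ s, m x = 0 → y = z) := by
  by_cases h : ∑ x ∈ s, m x = 0
  · refine ⟨z, fun j => ?_, fun _ => rfl⟩
    rw [h, zero_mul, Finset.sum_eq_zero]
    intro x hx
    rw [(Finset.sum_eq_zero_iff_of_nonneg hm).1 h x hx, zero_mul]
  · exact ⟨fun j => (∑ x ∈ s, m x * x j) / ∑ x ∈ s, m x, fun j => mul_div_cancel₀ _ h,
      fun h0 => absurd h0 h⟩

/-- Linear functionals commute with barycenters. -/
theorem mul_sum_of_barycenter {s : Finset (ℕ → ℝ)} {m : (ℕ → ℝ) → ℝ} {g : ℝ} {y : ℕ → ℝ}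
    (h : ∀ j, g * y j = ∑ x ∈ s, m x * x j) (T : Finset ℕ) (c : ℕ → ℝ) :
    g * ∑ j ∈ T, y j * c j = ∑ x ∈ s, m x * ∑ j ∈ T, x j * c j := by
  simp only [Finset.mul_sum, ← mul_assoc, h, Finset.sum_mul]
  exact Finset.sum_comm

theorem mul_Uc_of_barycenter {s : Finset (ℕ → ℝ)} {m : (ℕ → ℝ) → ℝ} {g : ℝ} {y : ℕ → ℝ}
    (h : ∀ j, g * y j = ∑ x ∈ s, m x * x j) (K : ℕ) (v : ℕ → ℝ) (i : ℕ) :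
    g * Uc K v i y = ∑ x ∈ s, m x * Uc K v i x :=
  mul_sum_of_barycenter h _ _

theorem mul_Up_of_barycenter {s : Finset (ℕ → ℝ)} {m : (ℕ → ℝ) → ℝ} {g : ℝ} {y : ℕ → ℝ}
    (h : ∀ j, g * y j = ∑ x ∈ s, m x * x j) (K : ℕ) (v : ℕ → ℝ) (i : ℕ) :
    g * Up K v i y = ∑ x ∈ s, m x * Up K v i x := by
  have := mul_sum_of_barycenter h (Finset.Icc i K) (fun _ => v i)
  simpa only [Up, mul_comm (v i), ← Finset.sum_mul] using this

theorem simplex_of_barycenter {K : ℕ} {s : Finset (ℕ → ℝ)} {m : (ℕ → ℝ) → ℝ} {y : ℕ → ℝ}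
    (h : ∀ j, (∑ x ∈ s, m x) * y j = ∑ x ∈ s, m x * x j) (hm : ∀ x ∈ s, 0 ≤ m x)
    (hg : 0 < ∑ x ∈ s, m x) (hs : ∀ x ∈ s, x ∈ simplex K) : y ∈ simplex K := by
  refine ⟨fun k hk => ?_, ?_⟩
  · refine nonneg_of_mul_nonneg_right ?_ hg
    rw [h]
    exact Finset.sum_nonneg fun x hx => mul_nonneg (hm x hx) ((hs x hx).1 k hk)
  · have := mul_sum_of_barycenter h (Finset.Icc 1 K) (fun _ => 1)
    simp only [mul_one] at this
    refine mul_left_cancel₀ hg.ne' ?_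
    rw [this, mul_one]
    exact Finset.sum_congr rfl fun x hx => by rw [(hs x hx).2, mul_one]

theorem Xopt_of_barycenter {K : ℕ} {v : ℕ → ℝ} {β : ℝ} {i : ℕ} {s : Finset (ℕ → ℝ)}
    {m : (ℕ → ℝ) → ℝ} {y : ℕ → ℝ}
    (h : ∀ j, (∑ x ∈ s, m x) * y j = ∑ x ∈ s, m x * x j) (hm : ∀ x ∈ s, 0 ≤ m x)
    (hg : 0 < ∑ x ∈ s, m x) (hs : ∀ x ∈ s, x ∈ simplex K)
    (hopt : ∀ x ∈ s, 0 < m x → x ∈ Xopt K v β i) : y ∈ Xopt K v β i := by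
  refine ⟨simplex_of_barycenter h hm hg hs, fun j hj => ?_⟩
  have key : ∀ (l : ℕ) (C : ℝ),
      (∑ x ∈ s, m x) * (v l * ((1 - β) * ∑ k ∈ Finset.Icc l K, y k + C)) =
        ∑ x ∈ s, m x * (v l * ((1 - β) * ∑ k ∈ Finset.Icc l K, x k + C)) := by
    intro l C
    have hl := mul_sum_of_barycenter h (Finset.Icc l K) (fun _ => 1)
    simp only [mul_one] at hl
    calc _ = v l * (1 - β) * ((∑ x ∈ s, m x) * ∑ k ∈ Finset.Icc l K, y k)
          + (∑ x ∈ s, m x) * (v l * C) := by ring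
      _ = _ := by
        rw [hl, Finset.mul_sum, Finset.sum_mul, ← Finset.sum_add_distrib]
        exact Finset.sum_congr rfl fun x _ => by ring
  refine le_of_mul_le_mul_left ?_ hg
  rw [key, key]
  refine Finset.sum_le_sum fun x hx => ?_
  rcases (hm x hx).eq_or_lt with h0 | h0
  · rw [← h0, zero_mul, zero_mul]
  · exact mul_le_mul_of_nonneg_left ((hopt x hx h0).2 j hj) h0.le

/-- Every market admits an optimal price. -/
theorem exists_mem_Xopt {K : ℕ} (hK : 1 ≤ K) (v : ℕ → ℝ) (β : ℝ) {x : ℕ → ℝ}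
    (hx : x ∈ simplex K) : ∃ i ∈ Finset.Icc 1 K, x ∈ Xopt K v β i := by
  obtain ⟨i, hi, h⟩ := Finset.exists_max_image (Finset.Icc 1 K)
    (fun j => v j * ((1 - β) * ∑ k ∈ Finset.Icc j K, x k + β * ((K : ℝ) + 1 - j) / K))
    ⟨1, Finset.mem_Icc.2 ⟨le_rfl, hK⟩⟩
  exact ⟨i, hi, hx, h⟩

/-- A finite family of weighted markets, one per price, arises from a finitely supported
segmentation together with an optimal pricing rule. -/
theorem exists_segmentation {K : ℕ} (hK : 1 ≤ K) (v : ℕ → ℝ) (β : ℝ) {γ : ℕ → ℝ}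
    {xs : ℕ → ℕ → ℝ} (hγ : ∀ k ∈ Finset.Icc 1 K, 0 ≤ γ k)
    (hopt : ∀ k ∈ Finset.Icc 1 K, 0 < γ k → xs k ∈ Xopt K v β k) :
    ∃ (σ : (ℕ → ℝ) →₀ ℝ) (φ : (ℕ → ℝ) → ℕ → ℝ),
      (∀ x ∈ σ.support, x ∈ simplex K) ∧ (∀ x, 0 ≤ σ x) ∧
      (∀ x ∈ simplex K,
        (∀ k ∈ Finset.Icc 1 K, 0 ≤ φ x k) ∧
        (∑ k ∈ Finset.Icc 1 K, φ x k) = 1 ∧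
        (∀ k ∈ Finset.Icc 1 K, 0 < φ x k → x ∈ Xopt K v β k)) ∧
      ∀ G : ℕ → (ℕ → ℝ) → ℝ,
        σ.sum (fun x w => w * ∑ k ∈ Finset.Icc 1 K, φ x k * G k x) =
          ∑ k ∈ Finset.Icc 1 K, γ k * G k (xs k) := by
  classical
  set σ : (ℕ → ℝ) →₀ ℝ := ∑ k ∈ Finset.Icc 1 K, Finsupp.single (xs k) (γ k) with hσ
  have hσx : ∀ x, σ x = ∑ k ∈ Finset.Icc 1 K, if xs k = x then γ k else 0 := fun x => by
    simp [hσ, Finsupp.finsetSum_apply, Finsupp.single_apply]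
  have hnn : ∀ x, ∀ k ∈ Finset.Icc 1 K, 0 ≤ if xs k = x then γ k else 0 := fun x k hk => by
    split_ifs
    exacts [hγ k hk, le_rfl]
  have hσ0 : ∀ x, 0 ≤ σ x := fun x => hσx x ▸ Finset.sum_nonneg (hnn x)
  have hp : ∀ x, ∃ i, x ∈ simplex K → i ∈ Finset.Icc 1 K ∧ x ∈ Xopt K v β i := fun x => by
    by_cases hx : x ∈ simplex K
    · obtain ⟨i, hi⟩ := exists_mem_Xopt hK v β hx
      exact ⟨i, fun _ => hi⟩
    · exact ⟨0, fun h => absurd h hx⟩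
  choose p hp using hp
  set φ : (ℕ → ℝ) → ℕ → ℝ := fun x k =>
    if σ x = 0 then (if k = p x then 1 else 0) else (if xs k = x then γ k else 0) / σ x with hφ
  have hmul : ∀ x, ∀ k ∈ Finset.Icc 1 K, σ x * φ x k = if xs k = x then γ k else 0 := by
    intro x k hk
    by_cases h : σ x = 0
    · rw [h, zero_mul]
      exact ((Finset.sum_eq_zero_iff_of_nonneg (hnn x)).1 (hσx x ▸ h) k hk).symm
    · simp only [hφ, if_neg h]
      exact mul_div_cancel₀ _ h
  refine ⟨σ, φ, fun x hx => ?_, hσ0, fun x hx => ⟨fun k hk => ?_, ?_, fun k hk hpos => ?_⟩,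
    fun G => ?_⟩
  · rw [Finsupp.mem_support_iff, hσx] at hx
    obtain ⟨k, hk, hne⟩ := Finset.exists_ne_zero_of_sum_ne_zero hx
    rw [ite_ne_right_iff] at hne
    exact hne.1 ▸ (hopt k hk ((hγ k hk).lt_of_ne' hne.2)).1
  · simp only [hφ]
    split_ifs
    exacts [zero_le_one, le_rfl, div_nonneg (hγ k hk) (hσ0 x), div_nonneg le_rfl (hσ0 x)]
  · by_cases h : σ x = 0
    · simp only [hφ, if_pos h]
      rw [Finset.sum_ite_eq', if_pos (hp x hx).1]
    · simp only [hφ, if_neg h]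
      rw [← Finset.sum_div, ← hσx, div_self h]
  · by_cases h : σ x = 0
    · simp only [hφ, if_pos h] at hpos
      have hkp : k = p x := by
        by_contra hkp
        simp [hkp] at hpos
      exact hkp ▸ (hp x hx).2
    · have hpos' := mul_pos ((hσ0 x).lt_of_ne' h) hpos
      rw [hmul x k hk] at hpos'
      have hkx : xs k = x := by
        by_contra hkx
        simp [hkx] at hpos'
      rw [if_pos hkx] at hpos'
      exact hkx ▸ hopt k hk hpos'
  · simp only [Finsupp.sum, Finset.mul_sum, ← mul_assoc]
    rw [Finset.sum_comm]
    refine Finset.sum_congr rfl fun k hk => ?_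
    rw [Finset.sum_congr rfl fun x _ => by rw [hmul x k hk, ite_mul, zero_mul],
      Finset.sum_ite_eq]
    split_ifs with hmem
    · rfl
    · have h0 := (Finset.sum_eq_zero_iff_of_nonneg (hnn (xs k))).1
        (hσx (xs k) ▸ Finsupp.notMem_support_iff.1 hmem) k hk
      rw [if_pos rfl] at h0
      rw [h0, zero_mul]

/-- Proposition, merging step: the set `S₁` of utility pairs
generated by arbitrary finitely supported segmentations `σ` of `x*` together with
optimal pricing rules `φ` equals `S'`. -/
theorem stmt_19 (K : ℕ) (hK : 1 ≤ K) (v xstar : ℕ → ℝ)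
    (hv : ∀ k ∈ Finset.Icc 1 K, 0 < v k)
    (hmono : ∀ j ∈ Finset.Icc 1 K, ∀ k ∈ Finset.Icc 1 K, j < k → v j < v k)
    (β : ℝ) (hβ0 : 0 ≤ β) (hβ1 : β < 1)
    (hxstar : xstar ∈ simplex K) :
    {p : ℝ × ℝ | ∃ (σ : (ℕ → ℝ) →₀ ℝ) (φ : (ℕ → ℝ) → ℕ → ℝ),
      (∀ x ∈ σ.support, x ∈ simplex K) ∧
      (∀ x, 0 ≤ σ x ∧ σ x ≤ 1) ∧
      σ.sum (fun _ w => w) = 1 ∧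
      (∀ j ∈ Finset.Icc 1 K, σ.sum (fun x w => w * x j) = xstar j) ∧
      (∀ x ∈ simplex K,
        (∀ k ∈ Finset.Icc 1 K, 0 ≤ φ x k) ∧
        (∑ k ∈ Finset.Icc 1 K, φ x k) = 1 ∧
        (∀ k ∈ Finset.Icc 1 K, 0 < φ x k → x ∈ Xopt K v β k)) ∧
      p = (σ.sum (fun x w => w * ∑ k ∈ Finset.Icc 1 K, φ x k * Uc K v k x),
           σ.sum (fun x w => w * ∑ k ∈ Finset.Icc 1 K, φ x k * Up K v k x))}
    = Sprime K v β xstar := by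
  ext q
  constructor
  · rintro ⟨σ, φ, hsupp, hσ, hσ1, hσx, hφ, rfl⟩
    have hm : ∀ k ∈ Finset.Icc 1 K, ∀ x ∈ σ.support, 0 ≤ σ x * φ x k := fun k hk x hx =>
      mul_nonneg (hσ x).1 ((hφ x (hsupp x hx)).1 k hk)
    have hbary : ∀ k, ∃ y : ℕ → ℝ, k ∈ Finset.Icc 1 K →
        (∀ j, (∑ x ∈ σ.support, σ x * φ x k) * y j = ∑ x ∈ σ.support, σ x * φ x k * x j) ∧
        (∑ x ∈ σ.support, σ x * φ x k = 0 → y = xstar) := fun k => by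
      by_cases hk : k ∈ Finset.Icc 1 K
      · obtain ⟨y, hy⟩ := exists_barycenter σ.support (fun x => σ x * φ x k) (hm k hk) xstar
        exact ⟨y, fun _ => hy⟩
      · exact ⟨xstar, fun h => absurd h hk⟩
    choose xs hxs using hbary
    have hswap : ∀ f : (ℕ → ℝ) → ℝ,
        ∑ k ∈ Finset.Icc 1 K, ∑ x ∈ σ.support, σ x * φ x k * f x = σ.sum fun x w => w * f x := by
      intro f
      rw [Finset.sum_comm]
      refine Finset.sum_congr rfl fun x hx => ?_
      rw [← Finset.sum_mul, ← Finset.mul_sum, (hφ x (hsupp x hx)).2.1, mul_one]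
    have hutil : ∀ U : ℕ → (ℕ → ℝ) → ℝ,
        (∀ k ∈ Finset.Icc 1 K, (∑ x ∈ σ.support, σ x * φ x k) * U k (xs k) =
          ∑ x ∈ σ.support, σ x * φ x k * U k x) →
        σ.sum (fun x w => w * ∑ k ∈ Finset.Icc 1 K, φ x k * U k x) =
          ∑ k ∈ Finset.Icc 1 K, (∑ x ∈ σ.support, σ x * φ x k) * U k (xs k) := by
      intro U hU
      rw [Finset.sum_congr rfl hU, Finset.sum_comm]
      simp only [Finsupp.sum, Finset.mul_sum, mul_assoc]
    refine ⟨fun k => ∑ x ∈ σ.support, σ x * φ x k, xs,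
      fun k hk => Finset.sum_nonneg (hm k hk), ?_, fun k hk => ?_, fun k hk hpos => ?_,
      fun j hj => ?_, Prod.ext (hutil _ fun k hk => mul_Uc_of_barycenter (hxs k hk).1 K v k)
        (hutil _ fun k hk => mul_Up_of_barycenter (hxs k hk).1 K v k)⟩
    · have := hswap fun _ => 1
      simp only [mul_one] at this
      rw [this, hσ1]
    · rcases (Finset.sum_nonneg (hm k hk)).eq_or_lt with h | h
      · exact (hxs k hk).2 h.symm ▸ hxstar
      · exact simplex_of_barycenter (hxs k hk).1 (hm k hk) h hsupp
    · exact Xopt_of_barycenter (hxs k hk).1 (hm k hk) hpos hsupp fun x hx hx0 =>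
        (hφ x (hsupp x hx)).2.2 k hk (pos_of_mul_pos_right hx0 (hσ x).1)
    · rw [Finset.sum_congr rfl fun k hk => (hxs k hk).1 j, hswap, hσx j hj]
  · rintro ⟨γ, xs, hγ, hγ1, -, hopt, hx, rfl⟩
    obtain ⟨σ, φ, hsupp, hσ, hφ, hsum⟩ := exists_segmentation hK v β hγ hopt
    have hlin : ∀ f : (ℕ → ℝ) → ℝ,
        σ.sum (fun x w => w * f x) = ∑ k ∈ Finset.Icc 1 K, γ k * f (xs k) := by
      intro f
      rw [← hsum fun _ => f]
      refine Finset.sum_congr rfl fun x hx => ?_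
      simp only [← Finset.sum_mul, (hφ x (hsupp x hx)).2.1, one_mul]
    have htot : σ.sum (fun _ w => w) = 1 := by
      simpa only [mul_one, hγ1] using hlin fun _ => 1
    refine ⟨σ, φ, hsupp, fun x => ⟨hσ x, ?_⟩, htot, fun j hj => ?_, hφ,
      Prod.ext (hsum _).symm (hsum _).symm⟩
    · by_cases hx : x ∈ σ.support
      · exact (Finset.single_le_sum (fun y _ => hσ y) hx).trans_eq htot
      · rw [Finsupp.notMem_support_iff.1 hx]
        exact zero_le_one
    · rw [hlin fun x => x j, hx j hj]
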